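/- Let σ > 0 and μ ∈ ℝ, and let p : ℝ → ℝ be the normal density p(x) = (1/(√(2π)·σ))·exp(−(x−μ)²/(2σ²)). Then the (2,2) entry of the second-order Fisher information matrix satisfies ∫ p(x)²·[ ((x−μ)/σ²)²·((x−μ)²/σ³ − 1/σ)² + ((x−μ)²/σ³ − 1/σ)⁴ ] dx = 55·√π/(2⁵·π·σ⁵) = 55/(32·√π·σ⁵). -/

import Mathlib

open MeasureTheory

lemma integrable_pow_mul_exp_neg_mul_sq {b : ℝ} (hb : 0 < b) (n : ℕ) :
    Integrable fun y : ℝ => y ^ n * Real.exp (-b * y ^ 2) := by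
  have h : (-1 : ℝ) < n := neg_one_lt_zero.trans_le n.cast_nonneg
  simpa using integrable_rpow_mul_exp_neg_mul_sq hb h

/-- The recursion between Gaussian moments, from integrating by parts. -/
lemma integral_pow_add_two_mul_exp_neg_mul_sq {b : ℝ} (hb : 0 < b) (n : ℕ) :
    ∫ y : ℝ, y ^ (n + 2) * Real.exp (-b * y ^ 2)
      = (n + 1) / (2 * b) * ∫ y : ℝ, y ^ n * Real.exp (-b * y ^ 2) := by
  have hderiv (y : ℝ) : HasDerivAt (fun y : ℝ => y ^ (n + 1) * Real.exp (-b * y ^ 2))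
      ((n + 1) * (y ^ n * Real.exp (-b * y ^ 2))
        - 2 * b * (y ^ (n + 2) * Real.exp (-b * y ^ 2))) y := by
    convert! (hasDerivAt_pow (n + 1) y).mul (((hasDerivAt_pow 2 y).const_mul (-b)).exp) using 1
    push_cast
    ring
  have hn := (integrable_pow_mul_exp_neg_mul_sq hb n).const_mul ((n : ℝ) + 1)
  have hn2 := (integrable_pow_mul_exp_neg_mul_sq hb (n + 2)).const_mul (2 * b)
  have h := integral_eq_zero_of_hasDerivAt_of_integrable hderiv (hn.sub hn2)
    (integrable_pow_mul_exp_neg_mul_sq hb (n + 1))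
  rw [integral_sub hn hn2, integral_const_mul, integral_const_mul] at h
  rw [div_mul_eq_mul_div, eq_div_iff (by positivity)]
  linarith

/-- The integral of the second-order Fisher integrand of the standardised normal family. -/
lemma integral_exp_neg_sq_mul_score_polynomial :
    ∫ y : ℝ, Real.exp (-1 * y ^ 2) * (y ^ 2 * (y ^ 2 - 1) ^ 2 + (y ^ 2 - 1) ^ 4)
      = 55 / 16 * √Real.pi := by
  have hint := integrable_pow_mul_exp_neg_mul_sq one_pos
  have hrec := integral_pow_add_two_mul_exp_neg_mul_sq one_pos
  have h0 : ∫ y : ℝ, y ^ 0 * Real.exp (-1 * y ^ 2) = √Real.pi := by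
    simpa using integral_gaussian 1
  have h2 := hrec 0
  have h4 := hrec 2
  have h6 := hrec 4
  have h8 := hrec 6
  norm_num only [Nat.reduceAdd] at h2 h4 h6 h8
  have hexpand (y : ℝ) :
      Real.exp (-1 * y ^ 2) * (y ^ 2 * (y ^ 2 - 1) ^ 2 + (y ^ 2 - 1) ^ 4)
        = y ^ 8 * Real.exp (-1 * y ^ 2) + (-3) * (y ^ 6 * Real.exp (-1 * y ^ 2))
          + 4 * (y ^ 4 * Real.exp (-1 * y ^ 2)) + (-3) * (y ^ 2 * Real.exp (-1 * y ^ 2))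
          + y ^ 0 * Real.exp (-1 * y ^ 2) := by
    ring
  simp_rw [hexpand]
  have i6 := (hint 6).const_mul (-3)
  have i4 := (hint 4).const_mul 4
  have i2 := (hint 2).const_mul (-3)
  have i86 := (hint 8).fun_add i6
  have i84 := i86.fun_add i4
  have i82 := i84.fun_add i2
  rw [integral_add i82 (hint 0), integral_add i84 i2, integral_add i86 i4,
    integral_add (hint 8) i6]
  simp only [integral_const_mul]
  rw [h8, h6, h4, h2, h0]
  ring

/-- The (2,2) entry of the second-order Fisher information matrix of the normal family:
`∫ p²[(∂_μ ln p)²(∂_σ ln p)² + (∂_σ ln p)⁴] dx = 55√π/(2⁵π σ⁵) = 55/(32√π σ⁵)`. -/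
theorem second_fisher_matrix_normal_22
    (σ μ : ℝ) (hσ : 0 < σ) (p : ℝ → ℝ)
    (hp : p = fun x =>
      (1 / (Real.sqrt (2 * Real.pi) * σ)) * Real.exp (-(x - μ) ^ 2 / (2 * σ ^ 2))) :
    (∫ x, (p x) ^ 2 * (((x - μ) / σ ^ 2) ^ 2 * ((x - μ) ^ 2 / σ ^ 3 - 1 / σ) ^ 2
        + ((x - μ) ^ 2 / σ ^ 3 - 1 / σ) ^ 4))
      = 55 * Real.sqrt Real.pi / (2 ^ 5 * Real.pi * σ ^ 5) ∧
    55 * Real.sqrt Real.pi / (2 ^ 5 * Real.pi * σ ^ 5)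
      = 55 / (32 * Real.sqrt Real.pi * σ ^ 5) := by
  have hpi := Real.pi_pos
  constructor
  · set g : ℝ → ℝ := fun y =>
      Real.exp (-1 * y ^ 2) * (y ^ 2 * (y ^ 2 - 1) ^ 2 + (y ^ 2 - 1) ^ 4) with hg
    have hstd (x : ℝ) : (p x) ^ 2 * (((x - μ) / σ ^ 2) ^ 2 * ((x - μ) ^ 2 / σ ^ 3 - 1 / σ) ^ 2
        + ((x - μ) ^ 2 / σ ^ 3 - 1 / σ) ^ 4)
        = 1 / (2 * Real.pi * σ ^ 6) * g ((x - μ) / σ) := by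
      have hexp : Real.exp (-(x - μ) ^ 2 / (2 * σ ^ 2)) ^ 2
          = Real.exp (-1 * ((x - μ) / σ) ^ 2) := by
        rw [← Real.exp_nat_mul]
        congr 1
        push_cast
        field_simp
      have hsqrt : √(2 * Real.pi) ^ 2 = 2 * Real.pi := Real.sq_sqrt (by positivity)
      simp only [hp, hg]
      rw [mul_pow, hexp, div_pow, mul_pow, hsqrt]
      field_simp
    simp_rw [hstd]
    rw [integral_const_mul, integral_sub_right_eq_self (fun x => g (x / σ)) μ,
      Measure.integral_comp_div, integral_exp_neg_sq_mul_score_polynomial, abs_of_pos hσ,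
      smul_eq_mul]
    field_simp
    norm_num
  · field_simp
    rw [Real.sq_sqrt hpi.le]
    ring
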